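/- Let Γ be a countable group, S a finite symmetric generating set of Γ with 1 ∉ S, and μ a Γ-invariant percolation on Ω = (Γ × Γ → Bool) with μ(Ω₁) > 0. For ω ∈ Ω₁ let P_ω be the law on Γ^ℕ of the simple random walk on C_ω(1) started at 1, and let P_ω^ℤ be the probability measure on Γ^ℤ obtained as the pushforward of P_ω ⊗ P_ω under the gluing map (y, z) ↦ x with x_n = y_n and x_{−n} = z_n for n ≥ 0 (note y₀ = z₀ = 1). Let λ_ℤ = ∫_{Ω₁} δ_ω ⊗ P_ω^ℤ dμ'(ω) on Π_ℤ = Ω₁ × Γ^ℤ, where μ' is the degree-biased measure, and let U(ω, (x_n)_{n∈ℤ}) = (x₁⁻¹ • ω, (x₁⁻¹ x_{n+1})_{n∈ℤ}). Then for every Borel set A ⊆ Π_ℤ that is U-invariant (U⁻¹A = A up to λ_ℤ-null sets), the function f_A(ω) = P_ω^ℤ({x ∈ Γ^ℤ : (ω, x) ∈ A}) satisfies f_A(ω) ∈ {0, 1} for μ'-almost every ω ∈ Ω₁. -/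

import Mathlib

open MeasureTheory Filter
open scoped ENNReal

/-- The cluster of the identity in the percolation configuration `ω`. -/
def percCluster {Γ : Type*} [Group Γ] (S : Finset Γ) (ω : Γ × Γ → Bool) : Set Γ :=
  {g | Relation.ReflTransGen (fun x y : Γ => x⁻¹ * y ∈ S ∧ ω (x, y) = true) 1 g}

/-- The event that the cluster of the identity is infinite. -/
def percOmega1 {Γ : Type*} [Group Γ] (S : Finset Γ) : Set (Γ × Γ → Bool) :=
  {ω | (percCluster S ω).Infinite}

/-- The degree of `x` in the configuration `ω`. -/
def percDeg {Γ : Type*} [Group Γ] [DecidableEq Γ] (S : Finset Γ) (ω : Γ × Γ → Bool)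
    (x : Γ) : ℕ :=
  (S.filter (fun s => ω (x, x * s) = true)).card

/-- One-step transition probability of the simple random walk on the configuration `ω`. -/
noncomputable def percStep {Γ : Type*} [Group Γ] [DecidableEq Γ] (S : Finset Γ)
    (ω : Γ × Γ → Bool) (x z : Γ) : ℝ≥0∞ :=
  if 0 < percDeg S ω x then
    (if x⁻¹ * z ∈ S ∧ ω (x, z) = true then ((percDeg S ω x : ℝ≥0∞))⁻¹ else 0)
  else (if z = x then 1 else 0)

/-- The gluing map producing a bilateral path from two unilateral paths. -/
def glue {Γ : Type*} (yz : (ℕ → Γ) × (ℕ → Γ)) : ℤ → Γ :=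
  fun n => if 0 ≤ n then yz.1 n.toNat else yz.2 (-n).toNat

set_option linter.unusedSectionVars false

section helpers
variable {Γ : Type*} [Group Γ]

def pShift (g : Γ) (ω : Γ × Γ → Bool) : Γ × Γ → Bool := fun q => ω (g * q.1, g * q.2)

def pCons (s : Γ) (y : ℕ → Γ) : ℕ → Γ
  | 0 => 1
  | k + 1 => s * y k

def pT (k : ℤ) (p : (Γ × Γ → Bool) × (ℤ → Γ)) : (Γ × Γ → Bool) × (ℤ → Γ) :=
  (pShift (p.2 k) p.1, fun n => (p.2 k)⁻¹ * p.2 (n + k))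

lemma pShift_inv (g : Γ) (ω : Γ × Γ → Bool) : pShift g⁻¹ (pShift g ω) = ω := by
  funext q; simp [pShift]

lemma pT_comp (j k : ℤ) (p : (Γ × Γ → Bool) × (ℤ → Γ)) : pT j (pT k p) = pT (j + k) p := by
  simp only [pT, Prod.mk.injEq]
  refine ⟨?_, ?_⟩
  · funext q; simp [pShift, mul_assoc]
  · funext n; simp [mul_assoc, add_assoc]

lemma pT_zero (p : (Γ × Γ → Bool) × (ℤ → Γ)) (h : p.2 0 = 1) : pT 0 p = p := by
  ext <;> simp [pT, pShift, h]

lemma glue_ofNat (y z : ℕ → Γ) (n : ℤ) (k : ℕ) (h : n = k) : glue (y, z) n = y k := by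
  simp [glue, h]

lemma glue_neg (y z : ℕ → Γ) (n : ℤ) (k : ℕ) (h : n = -(k + 1 : ℤ)) :
    glue (y, z) n = z (k + 1) := by
  have h1 : ¬ (0 ≤ n) := by omega
  have h2 : (-n).toNat = k + 1 := by omega
  simp [glue, h1, h2]

lemma pT_glue (ω : Γ × Γ → Bool) (s : Γ) (y z : ℕ → Γ) (hy : y 0 = 1) (hz : z 0 = 1) :
    pT 1 (ω, glue (pCons s y, z)) = (pShift s ω, glue (y, pCons s⁻¹ z)) := by
  have h1 : glue (pCons s y, z) 1 = s := by
    rw [glue_ofNat _ _ _ 1 (by simp)]; simp [pCons, hy]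
  simp only [pT, Prod.mk.injEq, h1, true_and]
  funext n
  rcases n with k | k
  · rw [glue_ofNat _ _ _ (k+1) (by simp), glue_ofNat _ _ _ k (by simp)]; simp [pCons]
  · rw [glue_neg y _ _ k (by omega)]
    rcases k with _ | k
    · rw [glue_ofNat _ _ _ 0 (by simp)]; simp [pCons, hz]
    · rw [glue_neg _ _ _ k (by omega)]; simp [pCons]

lemma percDeg_shift [DecidableEq Γ] (S : Finset Γ) (g : Γ) (ω : Γ × Γ → Bool) (x : Γ) :
    percDeg S (pShift g ω) x = percDeg S ω (g * x) := by
  simp only [percDeg, pShift, mul_assoc]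
  congr

lemma percStep_shift [DecidableEq Γ] (S : Finset Γ) (g : Γ) (ω : Γ × Γ → Bool) (x y : Γ) :
    percStep S (pShift g ω) x y = percStep S ω (g * x) (g * y) := by
  simp only [percStep, percDeg_shift]
  simp [pShift, mul_assoc]
  congr

lemma omega1_shift_aux (S : Finset Γ) (g : Γ) (hg : g⁻¹ ∈ S) (ω : Γ × Γ → Bool)
    (h : ω (g, 1) = true) (hω : ω ∈ percOmega1 S) : pShift g ω ∈ percOmega1 S := by
  have hω' : (percCluster S ω).Infinite := hω
  have : ((fun x => g⁻¹ * x) '' percCluster S ω).Infinite :=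
    hω'.image (mul_right_injective _).injOn
  refine Set.Infinite.mono ?_ this
  rintro _ ⟨x, hx, rfl⟩
  have hx' : Relation.ReflTransGen (fun x y : Γ => x⁻¹ * y ∈ S ∧ ω (x, y) = true) 1 x := hx
  have h2 : Relation.ReflTransGen (fun x y : Γ => x⁻¹ * y ∈ S ∧ ω (x, y) = true) g x :=
    Relation.ReflTransGen.head ⟨by simpa using hg, h⟩ hx'
  show Relation.ReflTransGen _ _ _
  have h3 := h2.lift (p := fun x y : Γ => x⁻¹ * y ∈ S ∧ pShift g ω (x, y) = true)
    (fun x => g⁻¹ * x) (by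
      rintro a b ⟨h1, h2⟩
      exact ⟨by simpa [mul_assoc] using h1, by simpa [pShift] using h2⟩)
  have h4 := h3 
  simp only [Function.onFun, inv_mul_cancel] at h4
  exact h4

lemma omega1_shift (S : Finset Γ) (hSsymm : ∀ s ∈ S, s⁻¹ ∈ S) (g : Γ) (hg : g ∈ S)
    (ω : Γ × Γ → Bool) (hs : ∀ x y, ω (x, y) = ω (y, x))
    (h : ω (1, g) = true) : pShift g ω ∈ percOmega1 S ↔ ω ∈ percOmega1 S := by
  constructor
  · intro h1
    have := omega1_shift_aux S g⁻¹ (by simpa using hg) (pShift g ω) (by simp [pShift, h]) h1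
    rwa [pShift_inv] at this
  · exact omega1_shift_aux S g (hSsymm g hg) ω (by rw [hs, h])

section meas
variable [Countable Γ] [MeasurableSpace Γ] [MeasurableSingletonClass Γ]

lemma measurable_pShift (g : Γ) : Measurable (pShift g) := by
  unfold pShift; fun_prop

lemma measurable_pCons (g : Γ) : Measurable (pCons g) := by
  rw [measurable_pi_iff]
  rintro (_ | n)
  · exact measurable_const
  · exact (Measurable.of_discrete (f := fun x : Γ => g * x)).comp (measurable_pi_apply n)

lemma measurable_glue : Measurable (glue (Γ := Γ)) := by
  rw [measurable_pi_iff]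
  intro n
  unfold glue
  split_ifs <;> fun_prop

lemma measurable_pT (k : ℤ) : Measurable (pT (Γ := Γ) k) := by
  have : Measurable (fun q : Γ × ((Γ × Γ → Bool) × (ℤ → Γ)) =>
      ((pShift q.1 q.2.1, fun n => q.1⁻¹ * q.2.2 (n + k)) : (Γ × Γ → Bool) × (ℤ → Γ))) := by
    apply measurable_from_prod_countable_right
    intro g
    refine Measurable.prodMk ((measurable_pShift g).comp measurable_fst) ?_
    rw [measurable_pi_iff]
    intro n
    exact (Measurable.of_discrete (f := fun x : Γ => g⁻¹ * x)).comp
      ((measurable_pi_apply _).comp measurable_snd)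
  exact this.comp (f := fun p => (p.2 k, p)) (by fun_prop)

lemma measurable_deg [DecidableEq Γ] (S : Finset Γ) :
    Measurable (fun ω : Γ × Γ → Bool => percDeg S ω 1) := by
  simp only [percDeg, Finset.card_filter]
  refine Finset.measurable_sum _ fun s _ => ?_
  exact (Measurable.of_discrete (f := fun b : Bool => if b = true then 1 else 0)).comp
    (measurable_pi_apply _)

lemma measurableSet_cluster (S : Finset Γ) (g : Γ) :
    MeasurableSet {ω : Γ × Γ → Bool | g ∈ percCluster S ω} := by
  let R : ℕ → Γ → Set (Γ × Γ → Bool) := fun n => Nat.rec (fun g => {ω | g = 1})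
    (fun _ Q g => {ω | ∃ h : Γ, ω ∈ Q h ∧ (h⁻¹ * g ∈ S ∧ ω (h, g) = true)}) n
  have hR : ∀ n g, MeasurableSet (R n g) := by
    intro n
    induction n with
    | zero => intro g; exact MeasurableSet.const _
    | succ n ih =>
      intro g
      have : R (n+1) g = ⋃ h : Γ, (R n h ∩ {ω | (h⁻¹ * g ∈ S ∧ ω (h, g) = true)}) := by
        ext ω; simp [R]
      rw [this]
      refine MeasurableSet.iUnion fun h => (ih h).inter ?_
      refine MeasurableSet.inter (MeasurableSet.const _) ?_
      exact measurableSet_eq_fun (measurable_pi_apply (h, g)) measurable_const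
  have : {ω : Γ × Γ → Bool | g ∈ percCluster S ω} = ⋃ n, R n g := by
    ext ω
    simp only [Set.mem_ofPred_eq, Set.mem_iUnion, percCluster]
    constructor
    · intro h
      induction h with
      | refl => exact ⟨0, rfl⟩
      | tail _ h ih => obtain ⟨n, hn⟩ := ih; exact ⟨n+1, _, hn, h⟩
    · rintro ⟨n, hn⟩
      induction n generalizing g with
      | zero => 
        have : g = 1 := hn
        subst this; exact .refl
      | succ n ih => obtain ⟨h, h1, h2⟩ := hn; exact (ih h h1).tail h2
  rw [this]; exact MeasurableSet.iUnion fun n => hR n g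

lemma measurableSet_omega1 (S : Finset Γ) : MeasurableSet (percOmega1 S) := by
  have : percOmega1 S = ⋂ F : Finset Γ, ⋃ g : Γ, {ω | g ∉ F} ∩ {ω | g ∈ percCluster S ω} := by
    ext ω
    simp only [percOmega1, Set.mem_ofPred_eq, Set.mem_iInter, Set.mem_iUnion, Set.mem_inter_iff]
    constructor
    · intro h F
      obtain ⟨g, h1, h2⟩ := h.exists_notMem_finset F
      exact ⟨g, h2, h1⟩
    · intro h hf
      obtain ⟨g, h1, h2⟩ := h hf.toFinset
      exact h1 (by simpa using h2)
  rw [this]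
  exact MeasurableSet.iInter fun F => MeasurableSet.iUnion fun g =>
    (MeasurableSet.const _).inter (measurableSet_cluster S g)

def pCyl (n : ℕ) (y : ℕ → Γ) : Set (ℕ → Γ) := {x | ∀ i ≤ n, x i = y i}

lemma measurableSet_pCyl (n : ℕ) (y : ℕ → Γ) : MeasurableSet (pCyl n y) := by
  have : pCyl n y = ⋂ i, ⋂ (_ : i ≤ n), (fun x : ℕ → Γ => x i) ⁻¹' {y i} := by
    ext x; simp [pCyl]
  rw [this]
  exact MeasurableSet.iInter fun i => MeasurableSet.iInter fun _ =>
    (measurable_pi_apply i) (measurableSet_singleton _)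

lemma cyl_gen : (MeasurableSpace.pi : MeasurableSpace (ℕ → Γ)) =
    MeasurableSpace.generateFrom {s | ∃ n y, s = pCyl n y} := by
  apply le_antisymm
  · refine iSup_le fun i => ?_
    rw [MeasurableSpace.comap_le_iff_le_map]
    intro s _
    show MeasurableSet[MeasurableSpace.generateFrom _] ((fun x : ℕ → Γ => x i) ⁻¹' s)
    have : (fun x : ℕ → Γ => x i) ⁻¹' s = ⋃ w : {w : Fin (i+1) → Γ // w (Fin.last i) ∈ s},
        pCyl i (fun k => if h : k < i + 1 then w.1 ⟨k, h⟩ else 1) := by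
      ext x
      simp only [Set.mem_preimage, Set.mem_iUnion, pCyl, Set.mem_ofPred_eq]
      constructor
      · intro h
        refine ⟨⟨fun k => x k, by simpa using h⟩, fun k hk => ?_⟩
        simp [Nat.lt_succ_of_le hk]
      · rintro ⟨w, hw⟩
        have := hw i le_rfl
        simp at this
        rw [this]; exact w.2
    rw [this]
    exact MeasurableSet.iUnion fun w => MeasurableSpace.measurableSet_generateFrom ⟨_, _, rfl⟩
  · apply MeasurableSpace.generateFrom_le
    rintro _ ⟨n, y, rfl⟩
    exact measurableSet_pCyl n y

lemma cyl_pi : IsPiSystem {s : Set (ℕ → Γ) | ∃ n y, s = pCyl n y} := by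
  have key : ∀ n y m z, n ≤ m → (pCyl n y ∩ pCyl m z).Nonempty →
      pCyl n y ∩ pCyl m z = pCyl (Γ := Γ) m z := by
    rintro n y m z hnm ⟨x, hx1, hx2⟩
    refine Set.inter_eq_right.2 fun w hw i hi => ?_
    rw [hw i (hi.trans hnm), ← hx2 i (hi.trans hnm), hx1 i hi]
  rintro _ ⟨n, y, rfl⟩ _ ⟨m, z, rfl⟩ hne
  rcases le_total n m with h | h
  · exact ⟨m, z, key n y m z h hne⟩
  · rw [Set.inter_comm] at hne ⊢
    exact ⟨n, y, key m z n y h hne⟩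

lemma markov [DecidableEq Γ] (S : Finset Γ)
    (P : (Γ × Γ → Bool) → Measure (ℕ → Γ))
    (hPprob : ∀ ω, IsProbabilityMeasure (P ω))
    (hPcyl : ∀ ω : Γ × Γ → Bool, ∀ n : ℕ, ∀ y : ℕ → Γ,
      P ω {x : ℕ → Γ | ∀ i ≤ n, x i = y i} =
        (if y 0 = 1 then 1 else 0) * ∏ i ∈ Finset.range n, percStep S ω (y i) (y (i + 1)))
    (ω : Γ × Γ → Bool) :
    (percDeg S ω 1 : ℝ≥0∞) • P ω =
      ∑ s ∈ S.filter (fun s => ω (1, s) = true), (P (pShift s ω)).map (pCons s) := by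
  have hdeg : percDeg S ω 1 = (S.filter (fun s => ω (1, s) = true)).card := by
    simp [percDeg]
  have : IsFiniteMeasure ((percDeg S ω 1 : ℝ≥0∞) • P ω) :=
    ⟨by simp⟩
  refine ext_of_generate_finite _ cyl_gen cyl_pi ?_ ?_
  · rintro _ ⟨n, y, rfl⟩
    simp only [Measure.smul_apply, Measure.finsetSum_apply, smul_eq_mul]
    simp_rw [Measure.map_apply (measurable_pCons _) (measurableSet_pCyl n y)]
    by_cases hy : y 0 = 1
    swap
    · have h1 : ∀ s : Γ, pCons s ⁻¹' pCyl n y = ∅ := by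
        intro s; ext x
        simp only [Set.mem_preimage, pCyl, Set.mem_ofPred_eq, Set.mem_empty_iff_false, iff_false]
        intro h; exact hy (h 0 (Nat.zero_le _)).symm
      simp only [h1, measure_empty, Finset.sum_const_zero]
      rw [pCyl, hPcyl]; simp [hy]
    rcases n with _ | n
    · have h1 : ∀ s : Γ, pCons s ⁻¹' pCyl 0 y = Set.univ := by
        intro s; ext x
        simp [pCyl, hy, pCons]
      simp only [h1, measure_univ]
      rw [pCyl, hPcyl]
      simp [hy, hdeg]
    · have h1 : ∀ s : Γ, pCons s ⁻¹' pCyl (n+1) y =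
          {x | ∀ i ≤ n, x i = (fun i => s⁻¹ * y (i+1)) i} := by
        intro s; ext x
        simp only [Set.mem_preimage, pCyl, Set.mem_ofPred_eq]
        constructor
        · intro h i hi
          rw [← h (i+1) (by omega)]; simp [pCons]
        · rintro h (_ | i) hi
          · simp [pCons, hy]
          · simp [pCons, h i (by omega)]
      simp_rw [h1, hPcyl, percStep_shift]
      rw [pCyl, hPcyl, Finset.prod_range_succ']
      simp only [hy, if_true, one_mul, mul_inv_cancel_left]
      simp_rw [inv_mul_eq_one]
      simp only [ite_mul, one_mul, zero_mul, Finset.sum_ite_eq', Finset.mem_filter, zero_add]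
      rw [mul_comm (∏ i ∈ _, _), ← mul_assoc]
      have : (percDeg S ω 1 : ℝ≥0∞) * percStep S ω 1 (y 1) =
          if y 1 ∈ S ∧ ω (1, y 1) = true then 1 else 0 := by
        unfold percStep
        by_cases hh : y 1 ∈ S ∧ ω (1, y 1) = true
        · have : 0 < percDeg S ω 1 := by
            rw [hdeg]; exact Finset.card_pos.2 ⟨y 1, by simpa using hh⟩
          simp only [this, if_true, inv_one, one_mul, hh, and_self]
          exact ENNReal.mul_inv_cancel (by exact_mod_cast this.ne') (by simp)
        · by_cases h0 : 0 < percDeg S ω 1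
          · simp [hh, h0]
          · have h0' : percDeg S ω 1 = 0 := by omega
            simp [hh, h0']
      rw [this]; simp
  · simp only [Measure.smul_apply, Measure.finsetSum_apply, smul_eq_mul]
    simp_rw [Measure.map_apply (measurable_pCons _) MeasurableSet.univ]
    simp [hdeg]



lemma walk_start [DecidableEq Γ] (S : Finset Γ)
    (P : (Γ × Γ → Bool) → Measure (ℕ → Γ))
    (hPprob : ∀ ω, IsProbabilityMeasure (P ω))
    (hPcyl : ∀ ω : Γ × Γ → Bool, ∀ n : ℕ, ∀ y : ℕ → Γ,
      P ω {x : ℕ → Γ | ∀ i ≤ n, x i = y i} =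
        (if y 0 = 1 then 1 else 0) * ∏ i ∈ Finset.range n, percStep S ω (y i) (y (i + 1)))
    (ω : Γ × Γ → Bool) : ∀ᵐ y ∂(P ω), y 0 = 1 := by
  have h := hPcyl ω 0 (fun _ => 1)
  simp only [if_true, Finset.range_zero, Finset.prod_empty, mul_one] at h
  have h2 : ∀ᵐ y ∂(P ω), y ∈ pCyl 0 (fun _ => (1 : Γ)) :=
    (prob_compl_eq_zero_iff (measurableSet_pCyl _ _)).2 h
  filter_upwards [h2] with y hy
  exact hy 0 le_rfl

lemma markov_lintegral [DecidableEq Γ] (S : Finset Γ)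
    (P : (Γ × Γ → Bool) → Measure (ℕ → Γ))
    (hPprob : ∀ ω, IsProbabilityMeasure (P ω))
    (hPcyl : ∀ ω : Γ × Γ → Bool, ∀ n : ℕ, ∀ y : ℕ → Γ,
      P ω {x : ℕ → Γ | ∀ i ≤ n, x i = y i} =
        (if y 0 = 1 then 1 else 0) * ∏ i ∈ Finset.range n, percStep S ω (y i) (y (i + 1)))
    (ω : Γ × Γ → Bool) (f : (ℕ → Γ) → ℝ≥0∞) (hf : Measurable f) :
    (percDeg S ω 1 : ℝ≥0∞) * ∫⁻ y, f y ∂(P ω) =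
      ∑ s ∈ S, (if ω (1, s) = true then 1 else 0) * ∫⁻ y, f (pCons s y) ∂(P (pShift s ω)) := by
  rw [← smul_eq_mul, ← lintegral_smul_measure, markov S P hPprob hPcyl ω,
    lintegral_finsetSum_measure, Finset.sum_filter]
  refine Finset.sum_congr rfl fun s _ => ?_
  rw [lintegral_map hf (measurable_pCons s)]
  simp

lemma inv_lintegral [DecidableEq Γ] (S : Finset Γ) (hSsymm : ∀ s ∈ S, s⁻¹ ∈ S)
    (μ : Measure (Γ × Γ → Bool))
    (hinv : ∀ g : Γ, Measure.map (pShift g) μ = μ)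
    (hsymm : ∀ᵐ ω ∂μ, ∀ x y : Γ, ω (x, y) = ω (y, x))
    (P : (Γ × Γ → Bool) → Measure (ℕ → Γ))
    (hPprob : ∀ ω, IsProbabilityMeasure (P ω))
    (hPmeas : Measurable P)
    (hPcyl : ∀ ω : Γ × Γ → Bool, ∀ n : ℕ, ∀ y : ℕ → Γ,
      P ω {x : ℕ → Γ | ∀ i ≤ n, x i = y i} =
        (if y 0 = 1 then 1 else 0) * ∏ i ∈ Finset.range n, percStep S ω (y i) (y (i + 1)))
    (F : (Γ × Γ → Bool) × (ℤ → Γ) → ℝ≥0∞) (hF : Measurable F) :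
    ∫⁻ ω, (percOmega1 S).indicator 1 ω *
        ((percDeg S ω 1 : ℝ≥0∞) * ∫⁻ y, ∫⁻ z, F (pT 1 (ω, glue (y, z))) ∂(P ω) ∂(P ω)) ∂μ =
    ∫⁻ ω, (percOmega1 S).indicator 1 ω *
        ((percDeg S ω 1 : ℝ≥0∞) * ∫⁻ y, ∫⁻ z, F (ω, glue (y, z)) ∂(P ω) ∂(P ω)) ∂μ := by
  classical
  have hg := measurable_glue (Γ := Γ)
  let κ : ProbabilityTheory.Kernel (Γ × Γ → Bool) (ℕ → Γ) := ⟨P, hPmeas⟩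
  have : ProbabilityTheory.IsMarkovKernel κ := ⟨hPprob⟩
  let w : Γ → (Γ × Γ → Bool) → ℝ≥0∞ := fun s ω =>
    (percOmega1 S).indicator 1 ω * (if ω (1, s) = true then 1 else 0)
  let H : Γ → (Γ × Γ → Bool) → ℝ≥0∞ := fun s ω =>
    ∫⁻ y, ∫⁻ z, F (ω, glue (y, pCons s z)) ∂(P (pShift s ω)) ∂(P ω)
  have hw : ∀ s, Measurable (w s) := by
    intro s
    refine (measurable_one.indicator (measurableSet_omega1 S)).mul ?_
    exact (Measurable.of_discrete (f := fun b : Bool => if b = true then (1 : ℝ≥0∞) else 0)).comp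
      (measurable_pi_apply _)
  have hH : ∀ s, Measurable (H s) := by
    intro s
    let κs := κ.comap (pShift s) (measurable_pShift s)
    let κ2 : ProbabilityTheory.Kernel ((Γ × Γ → Bool) × (ℕ → Γ)) (ℕ → Γ) :=
      κs.comap Prod.fst measurable_fst
    have hc := measurable_pCons s
    have m1 : Measurable (fun q : ((Γ × Γ → Bool) × (ℕ → Γ)) × (ℕ → Γ) =>
        F (q.1.1, glue (q.1.2, pCons s q.2))) := by
      fun_prop
    have m2 : Measurable (fun q : (Γ × Γ → Bool) × (ℕ → Γ) =>
        ∫⁻ z, F (q.1, glue (q.2, pCons s z)) ∂(κ2 q)) :=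
      Measurable.lintegral_kernel_prod_right' m1
    exact Measurable.lintegral_kernel_prod_right' (κ := κ) m2
  have hwH : ∀ s, Measurable (fun ω => w s ω * H s ω) := fun s => (hw s).mul (hH s)
  have hT := measurable_pT (Γ := Γ) 1
  have L : ∀ᵐ ω ∂μ, (percOmega1 S).indicator 1 ω *
        ((percDeg S ω 1 : ℝ≥0∞) * ∫⁻ y, ∫⁻ z, F (pT 1 (ω, glue (y, z))) ∂(P ω) ∂(P ω)) =
        ∑ s ∈ S, w s⁻¹ (pShift s ω) * H s⁻¹ (pShift s ω) := by
    filter_upwards [hsymm] with ω hω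
    have mF : Measurable (fun q : (ℕ → Γ) × (ℕ → Γ) => F (pT 1 (ω, glue (q.1, q.2)))) := by
      fun_prop
    rw [markov_lintegral S P hPprob hPcyl ω _ mF.lintegral_prod_right', Finset.mul_sum]
    refine Finset.sum_congr rfl fun s hs => ?_
    rw [← mul_assoc]
    by_cases h : ω (1, s) = true
    · congr 1
      · simp only [w, Set.indicator_apply, omega1_shift S hSsymm s hs ω hω h]
        simp [pShift, h, hω s 1]
      · simp only [H, pShift_inv]
        refine lintegral_congr_ae ?_
        filter_upwards [walk_start S P hPprob hPcyl (pShift s ω)] with y hy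
        refine lintegral_congr_ae ?_
        filter_upwards [walk_start S P hPprob hPcyl ω] with z hz
        rw [pT_glue ω s y z hy hz]
    · have h' : ¬ pShift s ω (1, s⁻¹) = true := by simpa [pShift, hω s 1] using h
      simp [w, h, h']
  have Rr : ∀ ω, (percOmega1 S).indicator 1 ω *
        ((percDeg S ω 1 : ℝ≥0∞) * ∫⁻ y, ∫⁻ z, F (ω, glue (y, z)) ∂(P ω) ∂(P ω)) =
        ∑ s ∈ S, w s ω * H s ω := by
    intro ω
    have mF : Measurable (fun q : (ℕ → Γ) × (ℕ → Γ) => F (ω, glue (q.1, q.2))) := by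
      fun_prop
    rw [← lintegral_const_mul _ mF.lintegral_prod_right']
    have : ∀ y, (percDeg S ω 1 : ℝ≥0∞) * ∫⁻ z, F (ω, glue (y, z)) ∂(P ω) =
        ∑ s ∈ S, (if ω (1, s) = true then 1 else 0) *
          ∫⁻ z, F (ω, glue (y, pCons s z)) ∂(P (pShift s ω)) := fun y =>
      markov_lintegral S P hPprob hPcyl ω (fun z => F (ω, glue (y, z))) (by fun_prop)
    simp_rw [this]
    have m3 : ∀ s, Measurable (fun y => ∫⁻ z, F (ω, glue (y, pCons s z)) ∂(P (pShift s ω))) := by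
      intro s
      have hc := measurable_pCons s
      exact Measurable.lintegral_prod_right'
        (f := fun q : (ℕ → Γ) × (ℕ → Γ) => F (ω, glue (q.1, pCons s q.2))) (by fun_prop)
    rw [lintegral_finsetSum _ (fun s _ => (m3 s).const_mul _), Finset.mul_sum]
    refine Finset.sum_congr rfl fun s hs => ?_
    rw [lintegral_const_mul _ (m3 s), ← mul_assoc]
  rw [lintegral_congr_ae L, lintegral_congr Rr,
    lintegral_finsetSum _ (fun s _ => hwH s),
    lintegral_finsetSum _ (f := fun s ω => w s⁻¹ (pShift s ω) * H s⁻¹ (pShift s ω))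
      (fun s _ => (hwH s⁻¹).comp (measurable_pShift s))]
  have e : ∀ s, ∫⁻ ω, w s⁻¹ (pShift s ω) * H s⁻¹ (pShift s ω) ∂μ =
      ∫⁻ ω, w s⁻¹ ω * H s⁻¹ ω ∂μ := by
    intro s
    rw [← lintegral_map (hwH s⁻¹) (measurable_pShift s), hinv]
  simp_rw [e]
  exact Finset.sum_nbij' (fun s => s⁻¹) (fun s => s⁻¹) hSsymm hSsymm (by simp) (by simp) (by simp)

def pLocal : Set (Set ((Γ × Γ → Bool) × (ℤ → Γ))) :=
  {B | MeasurableSet B ∧ ∃ m : ℕ, ∀ (ω : Γ × Γ → Bool) (x x' : ℤ → Γ),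
    (∀ i : ℤ, |i| ≤ m → x i = x' i) → ((ω, x) ∈ B ↔ (ω, x') ∈ B)}

lemma pLocal_alg : IsSetAlgebra (pLocal (Γ := Γ)) where
  empty_mem := ⟨MeasurableSet.empty, 0, by simp⟩
  compl_mem := by
    rintro s ⟨h1, m, h2⟩
    exact ⟨h1.compl, m, fun ω x x' h => not_congr (h2 ω x x' h)⟩
  union_mem := by
    rintro s t ⟨h1, m, h2⟩ ⟨h3, n, h4⟩
    refine ⟨h1.union h3, max m n, fun ω x x' h => or_congr (h2 ω x x' ?_) (h4 ω x x' ?_)⟩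
    · intro i hi; exact h i (hi.trans (by simp))
    · intro i hi; exact h i (hi.trans (by simp))

lemma pLocal_gen : (inferInstance : MeasurableSpace ((Γ × Γ → Bool) × (ℤ → Γ))) =
    MeasurableSpace.generateFrom (pLocal (Γ := Γ)) := by
  apply le_antisymm
  · refine sup_le ?_ ?_
    · rintro _ ⟨E, hE, rfl⟩
      exact MeasurableSpace.measurableSet_generateFrom ⟨measurable_fst hE, 0, by simp⟩
    · rw [MeasurableSpace.pi, MeasurableSpace.comap_iSup]
      refine iSup_le fun i => ?_
      rintro _ ⟨_, ⟨E, hE, rfl⟩, rfl⟩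
      refine MeasurableSpace.measurableSet_generateFrom
        ⟨((measurable_pi_apply i).comp measurable_snd) hE, i.natAbs, ?_⟩
      intro ω x x' h
      have := h i (by simp)
      simp [this]
  · exact MeasurableSpace.generateFrom_le fun s hs => hs.1

lemma glue_indep (Q : Measure (ℕ → Γ)) [IsProbabilityMeasure Q] (ω : Γ × Γ → Bool)
    (B : Set ((Γ × Γ → Bool) × (ℤ → Γ))) (m : ℕ)
    (hB : ∀ (ω : Γ × Γ → Bool) (x x' : ℤ → Γ),
      (∀ i : ℤ, |i| ≤ m → x i = x' i) → ((ω, x) ∈ B ↔ (ω, x') ∈ B)) :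
    (Q.prod Q) ({yz | (ω, glue yz) ∈ pT (m + 1 : ℤ) ⁻¹' B} ∩
        {yz | (ω, glue yz) ∈ pT (-(m + 1) : ℤ) ⁻¹' B}) =
      (Q.prod Q) {yz | (ω, glue yz) ∈ pT (m + 1 : ℤ) ⁻¹' B} *
        (Q.prod Q) {yz | (ω, glue yz) ∈ pT (-(m + 1) : ℤ) ⁻¹' B} := by
  have e1 : {yz : (ℕ → Γ) × (ℕ → Γ) | (ω, glue yz) ∈ pT (m + 1 : ℤ) ⁻¹' B} =
      {y | (ω, glue (y, fun _ => 1)) ∈ pT (m + 1 : ℤ) ⁻¹' B} ×ˢ Set.univ := by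
    ext ⟨y, z⟩
    simp only [Set.mem_ofPred_eq, Set.mem_prod, Set.mem_univ, and_true, Set.mem_preimage, pT]
    have e : ∀ i : ℤ, 0 ≤ i → glue (y, z) i = glue (y, fun _ => 1) i := by
      intro i hi; simp [glue, hi]
    rw [e (m + 1) (by omega)]
    apply hB
    intro i hi
    rw [e (i + (m + 1)) (by have := (abs_le.1 hi).1; omega)]
  have e2 : {yz : (ℕ → Γ) × (ℕ → Γ) | (ω, glue yz) ∈ pT (-(m + 1) : ℤ) ⁻¹' B} =
      Set.univ ×ˢ {z | (ω, glue (fun _ => 1, z)) ∈ pT (-(m + 1) : ℤ) ⁻¹' B} := by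
    ext ⟨y, z⟩
    simp only [Set.mem_ofPred_eq, Set.mem_prod, Set.mem_univ, true_and, Set.mem_preimage, pT]
    have e : ∀ i : ℤ, i < 0 → glue (y, z) i = glue (fun _ => 1, z) i := by
      intro i hi; simp [glue, hi.not_ge]
    rw [e (-(m + 1)) (by omega)]
    apply hB
    intro i hi
    rw [e (i + -(m + 1)) (by have := (abs_le.1 hi).2; omega)]
  rw [e1, e2, Set.prod_inter_prod, Set.inter_univ, Set.univ_inter, Measure.prod_prod,
    Measure.prod_prod, Measure.prod_prod, measure_univ, mul_one, one_mul]

lemma ennreal_est (Q : Measure ((ℕ → Γ) × (ℕ → Γ))) [IsProbabilityMeasure Q]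
    (A C C' : Set ((ℕ → Γ) × (ℕ → Γ))) (h : Q (C ∩ C') = Q C * Q C') :
    Q A - Q A * Q A ≤ 2 * (Q (symmDiff A C) + Q (symmDiff A C')) := by
  set a := Q (symmDiff A C)
  set b := Q (symmDiff A C')
  have h1 : Q A ≤ Q (C ∩ C') + (a + b) := by
    refine (measure_mono (t := (C ∩ C') ∪ (symmDiff A C ∪ symmDiff A C')) ?_).trans
      ((measure_union_le _ _).trans (by gcongr; exact measure_union_le _ _))
    intro x hx
    simp only [Set.mem_union, Set.mem_inter_iff, Set.mem_symmDiff]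
    tauto
  have h2 : Q C ≤ Q A + a := by
    refine (measure_mono (t := A ∪ symmDiff A C) ?_).trans (measure_union_le _ _)
    intro x hx
    simp only [Set.mem_union, Set.mem_symmDiff]
    tauto
  have h3 : Q C' ≤ Q A + b := by
    refine (measure_mono (t := A ∪ symmDiff A C') ?_).trans (measure_union_le _ _)
    intro x hx
    simp only [Set.mem_union, Set.mem_symmDiff]
    tauto
  rw [tsub_le_iff_left]
  calc Q A ≤ Q C * Q C' + (a + b) := h ▸ h1
    _ ≤ (Q A + a) * Q C' + (a + b) := by gcongr
    _ = Q A * Q C' + a * Q C' + (a + b) := by ring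
    _ ≤ Q A * (Q A + b) + a * 1 + (a + b) := by gcongr; exact prob_le_one
    _ = Q A * Q A + Q A * b + a + (a + b) := by ring
    _ ≤ Q A * Q A + 1 * b + a + (a + b) := by gcongr; exact prob_le_one
    _ = Q A * Q A + 2 * (a + b) := by ring
end meas
end helpers
/-- a zero–one law, conditional on the environment, for shift-invariant
events of the bilateral path bundle of an invariant percolation. -/
theorem stmt_13 {Γ : Type*} [Group Γ] [Countable Γ] [DecidableEq Γ]
    [MeasurableSpace Γ] [MeasurableSingletonClass Γ]
    (S : Finset Γ) (hS1 : (1 : Γ) ∉ S) (hSsymm : ∀ s ∈ S, s⁻¹ ∈ S)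
    (hSgen : Subgroup.closure (S : Set Γ) = ⊤)
    (μ : Measure (Γ × Γ → Bool)) [IsProbabilityMeasure μ]
    (hinv : ∀ g : Γ,
      Measure.map (fun (ω : Γ × Γ → Bool) (p : Γ × Γ) => ω (g⁻¹ * p.1, g⁻¹ * p.2)) μ = μ)
    (hsymm : ∀ᵐ ω ∂μ, ∀ x y : Γ, ω (x, y) = ω (y, x))
    (hpos : 0 < μ (percOmega1 S))
    (D : ℝ) (hD : D = ∫ ω in percOmega1 S, (percDeg S ω 1 : ℝ) ∂μ)
    (μ' : Measure (Γ × Γ → Bool))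
    (hμ' : μ' = μ.withDensity
      (Set.indicator (percOmega1 S) (fun ω => ENNReal.ofReal ((percDeg S ω 1 : ℝ) / D))))
    (P : (Γ × Γ → Bool) → Measure (ℕ → Γ))
    (hPprob : ∀ ω, IsProbabilityMeasure (P ω))
    (hPmeas : Measurable P)
    (hPcyl : ∀ ω : Γ × Γ → Bool, ∀ n : ℕ, ∀ y : ℕ → Γ,
      P ω {x : ℕ → Γ | ∀ i ≤ n, x i = y i} =
        (if y 0 = 1 then 1 else 0) * ∏ i ∈ Finset.range n, percStep S ω (y i) (y (i + 1)))
    -- the bilateral law `P_ω^ℤ`, obtained by gluing two independent copies of `P_ω`: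
    (PZ : (Γ × Γ → Bool) → Measure (ℤ → Γ))
    (hPZ : ∀ ω, PZ ω = Measure.map glue ((P ω).prod (P ω)))
    (lamZ : Measure ((Γ × Γ → Bool) × (ℤ → Γ)))
    (hlamZ : lamZ = μ'.bind (fun ω => (Measure.dirac ω).prod (PZ ω)))
    (U : ((Γ × Γ → Bool) × (ℤ → Γ)) → ((Γ × Γ → Bool) × (ℤ → Γ)))
    (hU : U = fun p =>
      (fun q : Γ × Γ => p.1 (p.2 1 * q.1, p.2 1 * q.2),
        fun n : ℤ => (p.2 1)⁻¹ * p.2 (n + 1))) :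
    ∀ A : Set ((Γ × Γ → Bool) × (ℤ → Γ)), MeasurableSet A →
      lamZ (symmDiff (U ⁻¹' A) A) = 0 →
      ∀ᵐ ω ∂μ', PZ ω {x : ℤ → Γ | (ω, x) ∈ A} = 0 ∨ PZ ω {x : ℤ → Γ | (ω, x) ∈ A} = 1 := by

  classical
  have hg := measurable_glue (Γ := Γ)
  have hinv' : ∀ g : Γ, Measure.map (pShift g) μ = μ := by
    intro g
    have := hinv g⁻¹
    simp only [inv_inv] at this
    exact this
  let κ : ProbabilityTheory.Kernel (Γ × Γ → Bool) (ℕ → Γ) := ⟨P, hPmeas⟩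
  have hκ : ProbabilityTheory.IsMarkovKernel κ := ⟨hPprob⟩
  have hstart := walk_start S P hPprob hPcyl
  have hUT : U = pT 1 := by rw [hU]; rfl
  -- formula for PZ
  have hPZm : ∀ ω, ∀ B : Set ((Γ × Γ → Bool) × (ℤ → Γ)), MeasurableSet B →
      PZ ω {x | (ω, x) ∈ B} = ((P ω).prod (P ω)) {yz | (ω, glue yz) ∈ B} := by
    intro ω B hB
    have hm : MeasurableSet {x : ℤ → Γ | (ω, x) ∈ B} := measurable_prodMk_left hB
    rw [hPZ, Measure.map_apply hg hm]
    rfl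
  -- formula for lamZ
  have hker : Measurable (fun ω => (Measure.dirac ω).prod (PZ ω)) := by
    have : (fun ω => (Measure.dirac ω).prod (PZ ω)) =
        (ProbabilityTheory.Kernel.prod ProbabilityTheory.Kernel.id
          ((ProbabilityTheory.Kernel.prod κ κ).map glue)) := by
      funext ω
      rw [ProbabilityTheory.Kernel.prod_apply, ProbabilityTheory.Kernel.map_apply _ hg,
        ProbabilityTheory.Kernel.prod_apply, ProbabilityTheory.Kernel.id_apply, hPZ]
      rfl
    rw [this]; exact ProbabilityTheory.Kernel.measurable _
  have hlam : ∀ B : Set ((Γ × Γ → Bool) × (ℤ → Γ)), MeasurableSet B →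
      lamZ B = ∫⁻ ω, ((P ω).prod (P ω)) {yz | (ω, glue yz) ∈ B} ∂μ' := by
    intro B hB
    rw [hlamZ, Measure.bind_apply hB hker.aemeasurable]
    refine lintegral_congr fun ω => ?_
    have : IsProbabilityMeasure (PZ ω) := by
      rw [hPZ]; exact Measure.isProbabilityMeasure_map hg.aemeasurable
    rw [Measure.dirac_prod, Measure.map_apply measurable_prodMk_left hB, ← hPZm ω B hB]
    rfl
  have hmeasB : ∀ B : Set ((Γ × Γ → Bool) × (ℤ → Γ)), MeasurableSet B →
      Measurable (fun ω => ((P ω).prod (P ω)) {yz | (ω, glue yz) ∈ B}) := by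
    intro B hB
    have h := ProbabilityTheory.Kernel.measurable_kernel_prodMk_left (κ := ProbabilityTheory.Kernel.prod κ κ)
      (t := {q : (Γ × Γ → Bool) × ((ℕ → Γ) × (ℕ → Γ)) | (q.1, glue q.2) ∈ B})
      ((measurable_fst.prodMk (hg.comp measurable_snd)) hB)
    simp only [ProbabilityTheory.Kernel.prod_apply] at h
    exact h
  -- density
  have hdens : ∀ f : (Γ × Γ → Bool) → ℝ≥0∞, Measurable f → ∫⁻ ω, f ω ∂μ' =
      ENNReal.ofReal D⁻¹ *
        ∫⁻ ω, (percOmega1 S).indicator 1 ω * ((percDeg S ω 1 : ℝ≥0∞) * f ω) ∂μ := by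
    intro f hf
    have hdm : Measurable (fun ω : Γ × Γ → Bool => (percDeg S ω 1 : ℝ)) :=
      measurable_from_top.comp (measurable_deg S)
    have hden : Measurable ((percOmega1 S).indicator
        (fun ω => ENNReal.ofReal ((percDeg S ω 1 : ℝ) / D))) :=
      (ENNReal.measurable_ofReal.comp (hdm.div_const D)).indicator (measurableSet_omega1 S)
    rw [hμ', lintegral_withDensity_eq_lintegral_mul _ hden hf,
      ← lintegral_const_mul' _ _ ENNReal.ofReal_ne_top]
    refine lintegral_congr fun ω => ?_
    by_cases h : ω ∈ percOmega1 S
    · simp only [Pi.mul_apply, Set.indicator_of_mem h, Pi.one_apply, one_mul]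
      rw [div_eq_mul_inv, ENNReal.ofReal_mul (by positivity), ENNReal.ofReal_natCast]
      ring
    · simp [h]
  have hμfin : IsFiniteMeasure μ' := by
    refine ⟨?_⟩
    rw [← lintegral_one, hdens _ measurable_const]
    refine ENNReal.mul_lt_top ENNReal.ofReal_lt_top ?_
    refine lt_of_le_of_lt (lintegral_mono (g := fun _ => (S.card : ℝ≥0∞)) fun ω => ?_) (by simp)
    have h1 : (percOmega1 S).indicator (1 : (Γ × Γ → Bool) → ℝ≥0∞) ω ≤ 1 :=
      Set.indicator_le_self' (by simp) ω
    have h2 : (percDeg S ω 1 : ℝ≥0∞) ≤ S.card := by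
      exact_mod_cast Finset.card_filter_le _ _
    calc _ ≤ (1 : ℝ≥0∞) * (S.card * 1) := by gcongr
      _ = _ := by simp
  have hlamfin : IsFiniteMeasure lamZ := by
    refine ⟨?_⟩
    rw [hlam _ MeasurableSet.univ]
    simp
  -- invariance
  have hmp : MeasurePreserving (pT 1) lamZ lamZ := by
    refine ⟨measurable_pT 1, ?_⟩
    ext B hB
    rw [Measure.map_apply (measurable_pT 1) hB, hlam _ (measurable_pT 1 hB), hlam _ hB,
      hdens _ (hmeasB _ (measurable_pT 1 hB)), hdens _ (hmeasB _ hB)]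
    congr 1
    have key := inv_lintegral S hSsymm μ hinv' hsymm P hPprob hPmeas hPcyl (B.indicator 1)
      (measurable_one.indicator hB)
    have conv : ∀ B : Set ((Γ × Γ → Bool) × (ℤ → Γ)), MeasurableSet B → ∀ ω,
        ((P ω).prod (P ω)) {yz | (ω, glue yz) ∈ B} =
        ∫⁻ y, ∫⁻ z, B.indicator 1 (ω, glue (y, z)) ∂(P ω) ∂(P ω) := by
      intro B hB ω
      have hB' : MeasurableSet {yz : (ℕ → Γ) × (ℕ → Γ) | (ω, glue yz) ∈ B} :=
        (measurable_prodMk_left.comp hg) hB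
      rw [← lintegral_indicator_one hB', lintegral_prod _
        (measurable_one.indicator hB').aemeasurable]
      rfl
    simp_rw [conv _ hB, conv _ (measurable_pT 1 hB)]
    exact key
  let R : (Γ × Γ → Bool) × (ℤ → Γ) → (Γ × Γ → Bool) × (ℤ → Γ) := fun p => (p.1, fun n => p.2 (-n))
  have hRm : Measurable R := by fun_prop
  have hR : MeasurePreserving R lamZ lamZ := by
    refine ⟨hRm, ?_⟩
    ext B hB
    rw [Measure.map_apply hRm hB, hlam _ (hRm hB), hlam _ hB]
    refine lintegral_congr fun ω => ?_
    have hB' : MeasurableSet {yz : (ℕ → Γ) × (ℕ → Γ) | (ω, glue yz) ∈ B} :=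
      (measurable_prodMk_left.comp hg) hB
    conv_rhs => rw [← Measure.prod_swap, Measure.map_apply measurable_swap hB']
    apply measure_congr
    have a1 : ∀ᵐ yz ∂((P ω).prod (P ω)), yz.1 0 = 1 :=
      Measure.quasiMeasurePreserving_fst.ae (hstart ω)
    have a2 : ∀ᵐ yz ∂((P ω).prod (P ω)), yz.2 0 = 1 :=
      Measure.quasiMeasurePreserving_snd.ae (hstart ω)
    filter_upwards [a1, a2] with yz h1 h2
    obtain ⟨y, z⟩ := yz
    have : (fun n => glue (y, z) (-n)) = glue (z, y) := by
      funext n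
      rcases lt_trichotomy n 0 with h | h | h
      · simp [glue, h.le, h.not_ge]
      · subst h; simpa [glue] using h1.trans h2.symm
      · simp [glue, h.le, h.not_ge]
    apply propext
    show R (ω, glue (y, z)) ∈ B ↔ (ω, glue (z, y)) ∈ B
    simp only [R, this]
  have hmp' : MeasurePreserving (pT (-1)) lamZ lamZ := by
    have : pT (Γ := Γ) (-1) = R ∘ pT 1 ∘ R := by
      funext p
      simp only [pT, R, Function.comp, Prod.mk.injEq, true_and]
      funext n
      rw [show -(-n + 1) = n + -1 by ring]
    rw [this]
    exact hR.comp (hmp.comp hR)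
  have hz0 : ∀ᵐ p ∂lamZ, p.2 0 = 1 := by
    have hm : MeasurableSet {p : (Γ × Γ → Bool) × (ℤ → Γ) | ¬ p.2 0 = 1} :=
      ((((measurable_pi_apply 0).comp measurable_snd :
        Measurable (fun p : (Γ × Γ → Bool) × (ℤ → Γ) => p.2 0)))
          (measurableSet_singleton (1 : Γ))).compl
    rw [ae_iff, hlam _ hm, lintegral_eq_zero_iff (hmeasB _ hm)]
    refine Eventually.of_forall fun ω => ?_
    have a1 : ∀ᵐ yz ∂((P ω).prod (P ω)), yz.1 0 = 1 :=
      Measure.quasiMeasurePreserving_fst.ae (hstart ω)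
    rw [ae_iff] at a1
    simpa [glue] using a1
  intro A hA hAU
  rw [hUT] at hAU
  have hA1 : pT 1 ⁻¹' A =ᵐ[lamZ] A := measure_symmDiff_eq_zero_iff.1 hAU
  have hA2 : pT (-1) ⁻¹' A =ᵐ[lamZ] A := by
    have h1 := hmp'.quasiMeasurePreserving.preimage_ae_eq hA1
    have h2 : pT (-1) ⁻¹' (pT 1 ⁻¹' A) =ᵐ[lamZ] A := by
      filter_upwards [hz0] with p hp
      apply propext
      show pT 1 (pT (-1) p) ∈ A ↔ p ∈ A
      rw [pT_comp, show (1 : ℤ) + -1 = 0 by norm_num, pT_zero p hp]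
    exact h1.symm.trans h2
  have it1 : ∀ k : ℕ, pT (Γ := Γ) (k + 1 : ℤ) = (pT 1)^[k + 1] := by
    intro k
    induction k with
    | zero => simp
    | succ k ih =>
      rw [Function.iterate_succ', ← ih]
      funext p
      simp only [Function.comp, pT_comp]
      congr 1
      push_cast; ring
  have it2 : ∀ k : ℕ, pT (Γ := Γ) (-(k + 1) : ℤ) = (pT (-1))^[k + 1] := by
    intro k
    induction k with
    | zero => simp
    | succ k ih =>
      rw [Function.iterate_succ', ← ih]
      funext p
      simp only [Function.comp, pT_comp]
      congr 1
      push_cast; ring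
  have approx : ∀ (f : (Γ × Γ → Bool) × (ℤ → Γ) → (Γ × Γ → Bool) × (ℤ → Γ)),
      MeasurePreserving f lamZ lamZ → f ⁻¹' A =ᵐ[lamZ] A → ∀ k B, MeasurableSet B →
      lamZ (symmDiff A (f^[k] ⁻¹' B)) = lamZ (symmDiff A B) := by
    intro f hf hfA k B hB
    have h1 : f^[k] ⁻¹' A =ᵐ[lamZ] A :=
      hf.quasiMeasurePreserving.preimage_iterate_ae_eq k hfA
    rw [← (hf.iterate k).measure_preimage (hA.symmDiff hB).nullMeasurableSet, Set.preimage_symmDiff]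
    exact measure_congr (h1.symm.symmDiff (ae_eq_refl _))
  have hdense := Measure.MeasureDense.of_generateFrom_isSetAlgebra_finite (μ := lamZ)
    pLocal_alg pLocal_gen
  let f : (Γ × Γ → Bool) → ℝ≥0∞ := fun ω => ((P ω).prod (P ω)) {yz | (ω, glue yz) ∈ A}
  have hfm : Measurable f := hmeasB A hA
  have bound : ∀ ε : ℝ, 0 < ε → ∫⁻ ω, (f ω - f ω * f ω) ∂μ' ≤ 4 * ENNReal.ofReal ε := by
    intro ε hε
    obtain ⟨B, ⟨hB, m, hBm⟩, hAB⟩ := hdense.approx A hA (measure_ne_top _ _) ε hε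
    have hC := measurable_pT (Γ := Γ) (m + 1 : ℤ) hB
    have hC' := measurable_pT (Γ := Γ) (-(m + 1) : ℤ) hB
    have b1 : lamZ (symmDiff A (pT (m + 1 : ℤ) ⁻¹' B)) ≤ ENNReal.ofReal ε := by
      rw [it1, approx _ hmp hA1 _ _ hB]; exact hAB.le
    have b2 : lamZ (symmDiff A (pT (-(m + 1) : ℤ) ⁻¹' B)) ≤ ENNReal.ofReal ε := by
      rw [it2, approx _ hmp' hA2 _ _ hB]; exact hAB.le
    rw [hlam _ (hA.symmDiff hC)] at b1
    rw [hlam _ (hA.symmDiff hC')] at b2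
    calc ∫⁻ ω, (f ω - f ω * f ω) ∂μ'
        ≤ ∫⁻ ω, 2 * (((P ω).prod (P ω)) {yz | (ω, glue yz) ∈ symmDiff A (pT (m + 1 : ℤ) ⁻¹' B)} +
          ((P ω).prod (P ω)) {yz | (ω, glue yz) ∈ symmDiff A (pT (-(m + 1) : ℤ) ⁻¹' B)}) ∂μ' :=
          lintegral_mono fun ω => ennreal_est _ _ _ _ (glue_indep (P ω) ω B m hBm)
      _ = 2 * (_ + _) := by
          rw [lintegral_const_mul' _ _ (by simp), lintegral_add_left (hmeasB _ (hA.symmDiff hC))]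
      _ ≤ 2 * (ENNReal.ofReal ε + ENNReal.ofReal ε) := by gcongr
      _ = 4 * ENNReal.ofReal ε := by ring
  have zero : ∫⁻ ω, (f ω - f ω * f ω) ∂μ' = 0 := by
    refine le_antisymm (ENNReal.le_of_forall_pos_le_add fun ε hε _ => ?_) bot_le
    have := bound (ε / 4) (by positivity)
    refine this.trans ?_
    rw [zero_add, show (4 : ℝ≥0∞) = ENNReal.ofReal 4 by simp,
      ← ENNReal.ofReal_mul (by norm_num), mul_div_cancel₀ _ (by norm_num : (4 : ℝ) ≠ 0)]
    simp
  rw [lintegral_eq_zero_iff (by fun_prop)] at zero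
  filter_upwards [zero] with ω hω
  rw [hPZm ω A hA]
  have h1 : f ω ≤ f ω * f ω := tsub_eq_zero_iff_le.1 hω
  have h2 : f ω ≤ 1 := prob_le_one
  show f ω = 0 ∨ f ω = 1
  by_cases h0 : f ω = 0
  · exact Or.inl h0
  · right
    refine le_antisymm h2 ?_
    have hne : f ω ≠ ∞ := ne_top_of_le_ne_top ENNReal.one_ne_top h2
    exact (ENNReal.mul_le_mul_iff_right h0 hne).1 (by simpa using h1)
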